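/- Let (S, d) be a metric space, A a finite nonempty set, L_Q ≥ 0, and 0 < ε ≤ |A|. Let Q : S × A → ℝ satisfy |Q(s,a) − Q(s',a)| ≤ L_Q · d(s,s') for all s, s' ∈ S and a ∈ A. Define the policy π_η(·|s) = Softmax(η·Q(s,·)) with η = log(|A|/ε)/ε. Then for all s, s' ∈ S, ∑_{a∈A} |π_η(a|s) − π_η(a|s')| ≤ (|A| · log(|A|/ε) · L_Q / ε) · d(s,s'). -/

import Mathlib

/-- The softmax operator on a finite nonempty set `A`. -/
noncomputable def softmax {A : Type*} [Fintype A] (x : A → ℝ) (a : A) : ℝ :=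
  Real.exp (x a) / ∑ b, Real.exp (x b)

lemma softmax_aux_exp {w : ℝ} (hw : 0 ≤ w) :
    2 * (Real.exp w - 1) ≤ w * (Real.exp w + 1) := by
  have hd : ∀ x : ℝ, HasDerivAt (fun x => x * (Real.exp x + 1) - 2 * (Real.exp x - 1))
      (1 * (Real.exp x + 1) + x * Real.exp x - 2 * Real.exp x) x := by
    intro x
    exact ((hasDerivAt_id x).mul ((Real.hasDerivAt_exp x).add_const 1)).sub
      (((Real.hasDerivAt_exp x).sub_const 1).const_mul 2)
  have hm : Monotone (fun x : ℝ => x * (Real.exp x + 1) - 2 * (Real.exp x - 1)) := by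
    apply monotone_of_deriv_nonneg (fun x => (hd x).differentiableAt)
    intro x
    rw [(hd x).deriv]
    have h1 := Real.add_one_le_exp (-x)
    have h2 : Real.exp x * Real.exp (-x) = 1 := by rw [← Real.exp_add]; simp
    have h3 := mul_le_mul_of_nonneg_left h1 (Real.exp_pos x).le
    show 0 ≤ _
    nlinarith
  have := hm hw
  simp at this
  linarith

lemma softmax_aux_exp_sub {s t δ : ℝ} (h : |s - t| ≤ 2 * δ) :
    |Real.exp s - Real.exp t| ≤ δ * (Real.exp s + Real.exp t) := by
  wlog hst : t ≤ s generalizing s t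
  · rw [abs_sub_comm, add_comm (Real.exp s)]
    exact this (by rwa [abs_sub_comm]) (le_of_not_ge hst)
  rw [abs_of_nonneg (sub_nonneg.2 hst)] at h
  rw [abs_of_nonneg (sub_nonneg.2 (Real.exp_le_exp.2 hst))]
  have h1 := softmax_aux_exp (sub_nonneg.2 hst)
  have h2 : Real.exp s = Real.exp t * Real.exp (s - t) := by rw [← Real.exp_add]; ring_nf
  have h3 := mul_le_mul_of_nonneg_left h1 (Real.exp_pos t).le
  have h4 := mul_le_mul_of_nonneg_right h (add_pos (Real.exp_pos s) (Real.exp_pos t)).le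
  rw [h2] at h4 ⊢
  nlinarith

lemma softmax_aux_l1 {A : Type*} [Fintype A] [Nonempty A] (x y : A → ℝ) (δ : ℝ)
    (h : ∀ a, |x a - y a| ≤ δ) : ∑ a, |softmax x a - softmax y a| ≤ 2 * δ := by
  set X := ∑ b, Real.exp (x b) with hX
  set Y := ∑ b, Real.exp (y b) with hY
  have hXp : 0 < X := Finset.sum_pos (fun b _ => Real.exp_pos _) Finset.univ_nonempty
  have hYp : 0 < Y := Finset.sum_pos (fun b _ => Real.exp_pos _) Finset.univ_nonempty
  have key : ∀ a, |softmax x a - softmax y a| ≤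
      δ * (Real.exp (x a) * Y + Real.exp (y a) * X) / (X * Y) := by
    intro a
    have e : softmax x a - softmax y a =
        (∑ b, (Real.exp (x a + y b) - Real.exp (y a + x b))) / (X * Y) := by
      simp only [softmax, Real.exp_add, Finset.sum_sub_distrib, ← Finset.mul_sum, ← hX, ← hY]
      field_simp
    rw [e, abs_div, abs_of_pos (mul_pos hXp hYp)]
    gcongr
    refine (Finset.abs_sum_le_sum_abs _ _).trans ?_
    calc _ ≤ ∑ b, δ * (Real.exp (x a + y b) + Real.exp (y a + x b)) := by
          apply Finset.sum_le_sum
          intro b _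
          apply softmax_aux_exp_sub
          have ha := abs_le.1 (h a)
          have hb := abs_le.1 (h b)
          rw [abs_le]
          constructor <;> linarith
      _ = _ := by
          simp only [Real.exp_add, ← Finset.mul_sum, Finset.sum_add_distrib, ← hX, ← hY]
  refine (Finset.sum_le_sum fun a _ => key a).trans (le_of_eq ?_)
  rw [← Finset.sum_div, ← Finset.mul_sum, Finset.sum_add_distrib, ← Finset.sum_mul,
    ← Finset.sum_mul, ← hX, ← hY]
  field_simp
  ring

/-- Theorem 2, smoothness conclusion: the softmax policy
induced by a coordinatewise `L_Q`-Lipschitz Q-function at inverse temperature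
`η = log(|A|/ε)/ε` is ℓ1-Lipschitz in the state with constant
`|A|·log(|A|/ε)·L_Q/ε`. -/
theorem softmax_policy_lipschitz_explicit_temperature
    {S A : Type*} [MetricSpace S] [Fintype A] [Nonempty A]
    (LQ ε : ℝ) (hLQ : 0 ≤ LQ) (hε : 0 < ε) (hεA : ε ≤ (Fintype.card A : ℝ))
    (Q : S → A → ℝ)
    (hQlip : ∀ s s' : S, ∀ a : A, |Q s a - Q s' a| ≤ LQ * dist s s') :
    ∀ s s' : S,
      ∑ a, |softmax (fun a' => (Real.log ((Fintype.card A : ℝ) / ε) / ε) * Q s a') a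
              - softmax (fun a' => (Real.log ((Fintype.card A : ℝ) / ε) / ε) * Q s' a') a|
        ≤ (Fintype.card A : ℝ) * Real.log ((Fintype.card A : ℝ) / ε) * LQ / ε
            * dist s s' := by
  intro s s'
  set n : ℝ := (Fintype.card A : ℝ) with hn
  set η := Real.log (n / ε) / ε with hη
  have hlog : 0 ≤ Real.log (n / ε) := Real.log_nonneg ((one_le_div hε).2 hεA)
  have hη0 : 0 ≤ η := div_nonneg hlog hε.le
  have hδ : 0 ≤ η * (LQ * dist s s') := by positivity
  have hR : n * Real.log (n / ε) * LQ / ε * dist s s' = n * (η * (LQ * dist s s')) := by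
    rw [hη]; ring
  rw [hR]
  rcases Nat.lt_or_ge 1 (Fintype.card A) with hc | hc
  · have h2 : (2 : ℝ) ≤ n := by rw [hn]; exact_mod_cast hc
    refine (softmax_aux_l1 _ _ (η * (LQ * dist s s')) ?_).trans
      (mul_le_mul_of_nonneg_right h2 hδ)
    intro a
    rw [← mul_sub, abs_mul, abs_of_nonneg hη0]
    exact mul_le_mul_of_nonneg_left (hQlip s s' a) hη0
  · have : Subsingleton A := Fintype.card_le_one_iff_subsingleton.1 hc
    have h1 : ∀ (x : A → ℝ) (a : A), softmax x a = 1 := by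
      intro x a
      have : ∑ b, Real.exp (x b) = Real.exp (x a) := Fintype.sum_subsingleton _ a
      rw [softmax, this, div_self (Real.exp_pos _).ne']
    simp only [h1, sub_self, abs_zero, Finset.sum_const_zero]
    exact mul_nonneg (Nat.cast_nonneg _) hδ
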